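/- arXiv:1912.03376 — 2 statements merged into one kernel-verified Lean document; each statement's English description precedes it below -/
import Mathlib

section
/- For every R ∈ ℕ and ε > 0 there is a constant C such that for every k-free D ∈ ℕ and every Z > 0: the number of R-tuples (d_1,…,d_R) of positive integers with lcm(d_1^k, …, d_R^k, D) ≤ Z is at most C·Z^ε·(Z/D)^{1/k}. -/
open scoped BigOperators

/-- The divisor bound at a single prime power, with a constant independent of the prime. -/
lemma add_one_le_mul_prime_pow_rpow {δ : ℝ} (hδ : 0 < δ) {p : ℕ} (hp : 2 ≤ p) (v : ℕ) :
    (v + 1 : ℝ) ≤ (1 + 1 / (δ * Real.log 2)) * ((p : ℝ) ^ v) ^ δ := by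
  have hlog : 0 < Real.log 2 := Real.log_pos one_lt_two
  have hp' : (2 : ℝ) ≤ p := by exact_mod_cast hp
  have h_exp : δ * Real.log 2 * v + 1 ≤ ((p : ℝ) ^ v) ^ δ := by
    calc δ * Real.log 2 * v + 1 ≤ Real.exp (δ * Real.log 2 * v) := Real.add_one_le_exp _
      _ = ((2 : ℝ) ^ v) ^ δ := by
        rw [Real.rpow_def_of_pos (by positivity), Real.log_pow]
        ring_nf
      _ ≤ ((p : ℝ) ^ v) ^ δ := by gcongr
  have hv : (0 : ℝ) ≤ v := v.cast_nonneg
  have hK : (0 : ℝ) ≤ 1 / (δ * Real.log 2) := by positivity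
  calc (v + 1 : ℝ) ≤ (1 + 1 / (δ * Real.log 2)) * (δ * Real.log 2 * v + 1) := by
        have h1 : 1 / (δ * Real.log 2) * (δ * Real.log 2 * v) = v := by field_simp
        have h2 : 0 ≤ δ * Real.log 2 * v := by positivity
        linarith
    _ ≤ _ := by gcongr

/-- At primes `p` with `2 ≤ p ^ δ` the divisor bound holds with constant `1`. -/
lemma add_one_le_prime_pow_rpow {δ : ℝ} {p : ℕ} (hp : (2 : ℝ) ≤ (p : ℝ) ^ δ) (v : ℕ) :
    (v + 1 : ℝ) ≤ ((p : ℝ) ^ v) ^ δ := by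
  calc (v + 1 : ℝ) ≤ 2 ^ v := by exact_mod_cast Nat.lt_two_pow_self
    _ ≤ ((p : ℝ) ^ δ) ^ v := by gcongr
    _ = ((p : ℝ) ^ v) ^ δ := by
      rw [← Real.rpow_natCast, ← Real.rpow_natCast, ← Real.rpow_mul p.cast_nonneg,
        ← Real.rpow_mul p.cast_nonneg, mul_comm]

/-- The divisor bound: the number of divisors of `n` is `O(n ^ δ)` for every `δ > 0`. -/
lemma exists_card_divisors_le_mul_rpow {δ : ℝ} (hδ : 0 < δ) :
    ∃ C : ℝ, 0 < C ∧ ∀ n : ℕ, n ≠ 0 → (n.divisors.card : ℝ) ≤ C * (n : ℝ) ^ δ := by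
  obtain ⟨N, hN⟩ : ∃ N : ℕ, ∀ p : ℕ, N ≤ p → (2 : ℝ) ≤ (p : ℝ) ^ δ := by
    have h := ((tendsto_rpow_atTop hδ).comp tendsto_natCast_atTop_atTop).eventually_ge_atTop 2
    exact Filter.eventually_atTop.1 h
  set K : ℝ := 1 + 1 / (δ * Real.log 2) with hK
  have hlog : 0 < Real.log 2 := Real.log_pos one_lt_two
  have hK1 : 1 ≤ K := by
    have : 0 ≤ 1 / (δ * Real.log 2) := by positivity
    linarith
  refine ⟨K ^ N, by positivity, fun n hn => ?_⟩
  calc (n.divisors.card : ℝ)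
      = ∏ p ∈ n.primeFactors, ((n.factorization p : ℝ) + 1) := by
        rw [Nat.card_divisors hn]
        push_cast
        rfl
    _ ≤ ∏ p ∈ n.primeFactors,
          (if p < N then K else 1) * ((p : ℝ) ^ n.factorization p) ^ δ := by
        refine Finset.prod_le_prod (fun _ _ => by positivity) fun p hp => ?_
        split_ifs with h
        · exact add_one_le_mul_prime_pow_rpow hδ (Nat.prime_of_mem_primeFactors hp).two_le _
        · rw [one_mul]
          exact add_one_le_prime_pow_rpow (hN p (not_lt.1 h)) _
    _ = K ^ (n.primeFactors.filter (· < N)).card * (n : ℝ) ^ δ := by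
        rw [Finset.prod_mul_distrib, Finset.prod_ite, Finset.prod_const, Finset.prod_const_one,
          mul_one, Real.finsetProd_rpow _ _ fun _ _ => by positivity]
        congr 2
        conv_rhs => rw [← Nat.prod_factorization_pow_eq_self hn]
        rw [Finsupp.prod, Nat.support_factorization]
        push_cast
        rfl
    _ ≤ K ^ N * (n : ℝ) ^ δ := by
        gcongr
        calc (n.primeFactors.filter (· < N)).card ≤ (Finset.range N).card :=
              Finset.card_le_card fun p hp => by simpa using (Finset.mem_filter.1 hp).2
          _ = N := Finset.card_range N

/-- The least common multiple of a finite family commutes with taking powers. -/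
lemma Finset.lcm_pow_eq_pow_lcm {ι : Type*} (s : Finset ι) (f : ι → ℕ) (k : ℕ) :
    (s.lcm fun i => f i ^ k) = s.lcm f ^ k := by
  classical
  induction s using Finset.induction_on with
  | empty => simp
  | insert a s _ ih =>
    rw [Finset.lcm_insert, Finset.lcm_insert, ih]
    exact Nat.pow_lcm_pow

/-- The cofactor of `gcd m D` in `m` is controlled by `lcm (m ^ k) D`. -/
lemma div_gcd_pow_mul_le_lcm {m D : ℕ} (k : ℕ) (hm : 0 < m) :
    (m / m.gcd D) ^ k * D ≤ (m ^ k).lcm D := by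
  have hr : 0 < m.gcd D := Nat.gcd_pos_of_pos_left _ hm
  have hg : (m ^ k).gcd D ≤ m.gcd D ^ k :=
    Nat.le_of_dvd (by positivity) (gcd_pow_left_dvd_pow_gcd (a := m) (b := D))
  have hmul : m.gcd D * (m / m.gcd D) = m := Nat.mul_div_cancel' (Nat.gcd_dvd_left _ _)
  refine Nat.le_of_mul_le_mul_left (c := m.gcd D ^ k) ?_ (by positivity)
  calc m.gcd D ^ k * ((m / m.gcd D) ^ k * D) = (m ^ k).gcd D * (m ^ k).lcm D := by
        rw [← mul_assoc, ← mul_pow, hmul, Nat.gcd_mul_lcm]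
    _ ≤ _ := Nat.mul_le_mul_right _ hg

/-- For every `R ∈ ℕ` and `ε > 0` there is a constant `C` such that for every
`k`-free `D ∈ ℕ` and every `Z > 0`, the number of `R`-tuples `(d_1, …, d_R)` of positive
integers with `lcm(d_1^k, …, d_R^k, D) ≤ Z` is at most `C · Z^ε · (Z/D)^(1/k)`. -/
theorem stmt_1 (k : ℕ) (hk : 2 ≤ k) (R : ℕ) (hR : 1 ≤ R) (ε : ℝ) (hε : 0 < ε) :
    ∃ C : ℝ, ∀ D : ℕ, (∀ p : ℕ, p.Prime → ¬ p ^ k ∣ D) → ∀ Z : ℝ, 0 < Z →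
      (({d : Fin R → ℕ | (∀ i, 1 ≤ d i) ∧
          ((Nat.lcm (Finset.univ.lcm fun i => d i ^ k) D : ℕ) : ℝ) ≤ Z}).ncard : ℝ)
        ≤ C * Z ^ ε * (Z / (D : ℝ)) ^ ((1 : ℝ) / k) := by
  obtain ⟨C, hC, hdiv⟩ := exists_card_divisors_le_mul_rpow (δ := ε / (R + 1)) (by positivity)
  set δ : ℝ := ε / (R + 1) with hδ
  have hδ0 : 0 < δ := by positivity
  have hk0 : k ≠ 0 := by omega
  refine ⟨C ^ (R + 1), fun D hD Z hZ => ?_⟩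
  have hD0 : 0 < D := Nat.pos_of_ne_zero fun h => hD 2 Nat.prime_two (h ▸ dvd_zero _)
  have hX : 0 ≤ (Z / (D : ℝ)) ^ ((1 : ℝ) / k) := by positivity
  set M : ℕ := ⌊(Z / (D : ℝ)) ^ ((1 : ℝ) / k)⌋₊ with hM
  let P : Finset (ℕ × ℕ) := (D.divisors ×ˢ Finset.Icc 1 M).filter fun x => ((x.1 * x.2 : ℕ) : ℝ) ≤ Z
  let T : Finset (Fin R → ℕ) :=
    P.biUnion fun x => Fintype.piFinset fun _ : Fin R => (x.1 * x.2).divisors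
  set S := {d : Fin R → ℕ | (∀ i, 1 ≤ d i) ∧
          ((Nat.lcm (Finset.univ.lcm fun i => d i ^ k) D : ℕ) : ℝ) ≤ Z} with hS
  rcases S.eq_empty_or_nonempty with hemp | ⟨d₀, hd₀, hd₀'⟩
  · rw [hemp, Set.ncard_empty, Nat.cast_zero]
    positivity
  have hL : ∀ d : Fin R → ℕ, (∀ i, 1 ≤ d i) →
      0 < Nat.lcm (Finset.univ.lcm fun i => d i ^ k) D := fun d hd => by
    refine Nat.lcm_pos (Nat.pos_of_ne_zero fun h => ?_) hD0
    obtain ⟨i, -, hi⟩ := Finset.lcm_eq_zero_iff.1 h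
    exact (pow_pos (hd i) k).ne' hi
  have key : ∀ d ∈ S, d ∈ T := by
    rintro d ⟨hd, hdZ⟩
    set m : ℕ := Finset.univ.lcm d with hm
    have hm0 : 0 < m := Nat.pos_of_ne_zero fun h => by
      obtain ⟨i, -, hi⟩ := Finset.lcm_eq_zero_iff.1 h
      have := hd i
      omega
    have hmk : m ^ k ∣ Finset.univ.lcm fun i => d i ^ k :=
      (Finset.lcm_pow_eq_pow_lcm _ d k).symm.dvd
    have hlcm : (((m ^ k).lcm D : ℕ) : ℝ) ≤ Z :=
      le_trans (by exact_mod_cast Nat.le_of_dvd (hL d hd) (Nat.lcm_dvd_lcm_of_dvd_left D hmk)) hdZ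
    have hmul : m.gcd D * (m / m.gcd D) = m := Nat.mul_div_cancel' (Nat.gcd_dvd_left _ _)
    have hr : 0 < m.gcd D := Nat.gcd_pos_of_pos_left _ hm0
    refine Finset.mem_biUnion.2 ⟨(m.gcd D, m / m.gcd D), ?_, ?_⟩
    · simp only [P, Finset.mem_filter, Finset.mem_product, Nat.mem_divisors, Finset.mem_Icc, hmul]
      refine ⟨⟨⟨Nat.gcd_dvd_right _ _, hD0.ne'⟩,
        Nat.div_pos (Nat.le_of_dvd hm0 (Nat.gcd_dvd_left _ _)) hr, ?_⟩, ?_⟩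
      · rw [hM]
        refine Nat.le_floor ?_
        rw [one_div, Real.le_rpow_inv_iff_of_pos (by positivity) (by positivity) (by positivity),
          Real.rpow_natCast, le_div_iff₀ (by positivity)]
        exact le_trans (by exact_mod_cast div_gcd_pow_mul_le_lcm k hm0) hlcm
      · refine le_trans ?_ hlcm
        exact_mod_cast (Nat.le_self_pow hk0 m).trans
          (Nat.le_of_dvd (Nat.lcm_pos (by positivity) hD0) (Nat.dvd_lcm_left _ _))
    · simp only [Fintype.mem_piFinset, Nat.mem_divisors, hmul]
      exact fun i => ⟨Finset.dvd_lcm (Finset.mem_univ i), hm0.ne'⟩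
  have hDZ : (D : ℝ) ≤ Z := by
    refine le_trans ?_ hd₀'
    exact_mod_cast Nat.le_of_dvd (hL d₀ hd₀) (Nat.dvd_lcm_right _ _)
  have hcard : ∀ x ∈ P,
      ((Fintype.piFinset fun _ : Fin R => (x.1 * x.2).divisors).card : ℝ) ≤ (C * Z ^ δ) ^ R := by
    intro x hx
    simp only [P, Finset.mem_filter, Finset.mem_product, Nat.mem_divisors, Finset.mem_Icc] at hx
    obtain ⟨⟨⟨hx1, -⟩, hx2, -⟩, hxZ⟩ := hx
    have hx0 : x.1 * x.2 ≠ 0 := mul_ne_zero (Nat.pos_of_dvd_of_pos hx1 hD0).ne' (by omega)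
    rw [Fintype.card_piFinset_const]
    push_cast
    refine pow_le_pow_left₀ (by positivity) ((hdiv _ hx0).trans ?_) R
    gcongr
  calc (S.ncard : ℝ) ≤ T.card := by
        rw [← Set.ncard_coe_finset]
        exact_mod_cast Set.ncard_le_ncard key T.finite_toSet
    _ ≤ ∑ x ∈ P, ((Fintype.piFinset fun _ : Fin R => (x.1 * x.2).divisors).card : ℝ) := by
        exact_mod_cast Finset.card_biUnion_le
    _ ≤ P.card * (C * Z ^ δ) ^ R := by
        rw [← nsmul_eq_mul]
        exact Finset.sum_le_card_nsmul _ _ _ hcard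
    _ ≤ ((C * Z ^ δ) * (Z / (D : ℝ)) ^ ((1 : ℝ) / k)) * (C * Z ^ δ) ^ R := by
        gcongr
        calc (P.card : ℝ) ≤ (D.divisors.card * M : ℕ) := by
              refine Nat.cast_le.2 ((Finset.card_filter_le _ _).trans ?_)
              rw [Finset.card_product, Nat.card_Icc, Nat.add_sub_cancel]
          _ ≤ _ := by
              push_cast
              gcongr
              · refine (hdiv D hD0.ne').trans ?_
                gcongr
              · exact Nat.floor_le hX
    _ = C ^ (R + 1) * (Z ^ δ) ^ (R + 1) * (Z / (D : ℝ)) ^ ((1 : ℝ) / k) := by ring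
    _ = C ^ (R + 1) * Z ^ ε * (Z / (D : ℝ)) ^ ((1 : ℝ) / k) := by
        rw [← Real.rpow_natCast (Z ^ δ), ← Real.rpow_mul hZ.le, hδ]
        push_cast
        rw [div_mul_cancel₀ _ (by positivity)]
end

section
/- Let R ∈ ℕ and let a_1,…,a_R be distinct non-negative integers. For t ≥ 1 and positive integers d_1,…,d_R let 𝒩_{d;a}(t) denote the number of positive integers n ≤ t satisfying n ≡ −a_i (mod d_i^k) for all i = 1,…,R. Then for every ε > 0 there is a constant C (depending on R, the a_i, k, ε) such that for all t ≥ 1 and Y > 0: Σ over R-tuples (d_1,…,d_R) with d_1⋯d_R > Y of 𝒩_{d;a}(t) is at most C·t^ε·( t·Y^{1−k+ε} + t^{2/(k+1)} ). -/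
open scoped BigOperators Classical

theorem exists_card_divisors_le_rpow (δ : ℝ) (hδ : 0 < δ) :
    ∃ C : ℝ, 1 ≤ C ∧ ∀ n : ℕ, n ≠ 0 → (n.divisors.card : ℝ) ≤ C * (n : ℝ) ^ δ := by
  have h2 : 1 < (2 : ℝ) ^ δ := Real.one_lt_rpow (by norm_num) hδ
  obtain ⟨P, hP⟩ := exists_nat_ge ((2 : ℝ) ^ δ⁻¹)
  set b : ℝ := 2 ^ δ - 1 with hb
  have hb0 : 0 < b := by linarith
  set c : ℝ := 1 + 1 / b with hc
  have hc1 : 1 ≤ c := by have := one_div_pos.2 hb0; linarith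
  have hlocal : ∀ p v : ℕ, 2 ≤ p →
      (v + 1 : ℝ) ≤ (if p < P then c else 1) * ((p : ℝ) ^ δ) ^ v := by
    intro p v hp
    split_ifs with hpP
    · have h1 : 1 + v * b ≤ (1 + b) ^ v := one_add_mul_le_pow (by linarith) v
      have h3 : (1 + b) ^ v ≤ ((p : ℝ) ^ δ) ^ v := by
        gcongr
        have : (2 : ℝ) ^ δ ≤ (p : ℝ) ^ δ := by gcongr; exact_mod_cast hp
        linarith
      calc (v + 1 : ℝ) ≤ v + 1 + (v * b + 1 / b) := by
            have : 0 ≤ v * b + 1 / b := by positivity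
            linarith
        _ = c * (1 + v * b) := by rw [hc]; field_simp; ring
        _ ≤ c * ((p : ℝ) ^ δ) ^ v := by gcongr; exact h1.trans h3
    · have hp2 : (2 : ℝ) ≤ (p : ℝ) ^ δ := by
        have h : (2 : ℝ) ^ δ⁻¹ ≤ p := hP.trans (by exact_mod_cast not_lt.1 hpP)
        calc (2 : ℝ) = ((2 : ℝ) ^ δ⁻¹) ^ δ := by
              rw [← Real.rpow_mul (by norm_num), inv_mul_cancel₀ hδ.ne', Real.rpow_one]
          _ ≤ (p : ℝ) ^ δ := by gcongr
      have h4 : (v + 1 : ℝ) ≤ 2 ^ v := by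
        exact_mod_cast Nat.lt_two_pow_self (n := v)
      rw [one_mul]
      exact h4.trans (by gcongr)
  refine ⟨c ^ P, one_le_pow₀ hc1, fun n hn => ?_⟩
  have hprod : ∏ p ∈ n.primeFactors, ((p : ℝ) ^ δ) ^ n.factorization p = (n : ℝ) ^ δ := by
    have h := Nat.prod_factorization_pow_eq_self hn
    rw [Finsupp.prod, Nat.support_factorization] at h
    conv_rhs => rw [← h]
    push_cast
    rw [← Real.finsetProd_rpow _ _ (fun i _ => by positivity)]
    refine Finset.prod_congr rfl fun p _ => ?_
    rw [← Real.rpow_natCast, ← Real.rpow_natCast, ← Real.rpow_mul (by positivity),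
      ← Real.rpow_mul (by positivity), mul_comm]
  have hsmall : ∏ p ∈ n.primeFactors, (if p < P then c else 1) ≤ c ^ P := by
    rw [← Finset.prod_filter, Finset.prod_const]
    refine pow_le_pow_right₀ hc1 ?_
    calc _ ≤ (Finset.range P).card := Finset.card_le_card fun p hp => by
            simpa using (Finset.mem_filter.1 hp).2
      _ = P := Finset.card_range P
  rw [Nat.card_divisors hn]
  push_cast
  calc _ ≤ ∏ p ∈ n.primeFactors, (if p < P then c else 1) * ((p : ℝ) ^ δ) ^ n.factorization p :=
        Finset.prod_le_prod (fun _ _ => by positivity) fun p hp =>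
          hlocal p _ (Nat.prime_of_mem_primeFactors hp).two_le
    _ ≤ _ := by
        rw [Finset.prod_mul_distrib, hprod]
        gcongr

theorem prod_le_lcm_mul_pow {ι : Type*} (s : Finset ι) (x : ι → ℕ) (B r : ℕ) (hB : 1 ≤ B)
    (hs : s.card ≤ r) (hx : ∀ i ∈ s, 0 < x i)
    (hg : ∀ i ∈ s, ∀ j ∈ s, i ≠ j → (x i).gcd (x j) ≤ B) :
    ∏ i ∈ s, x i ≤ s.lcm x * (B ^ r) ^ s.card := by
  induction s using Finset.induction_on with
  | empty => simp
  | insert i s hi ih =>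
    have hcard := Finset.card_insert_of_notMem hi
    have ih' := ih (by omega) (fun j hj => hx j (Finset.mem_insert_of_mem hj))
      fun j hj l hl => hg j (Finset.mem_insert_of_mem hj) l (Finset.mem_insert_of_mem hl)
    have hxi := hx i (Finset.mem_insert_self i s)
    have hgcd : (x i).gcd (s.lcm x) ≤ B ^ r := by
      have h1 : (x i).gcd (s.lcm x) ∣ ∏ j ∈ s, (x i).gcd (x j) := by
        have h2 : ∀ u : Finset ι, (x i).gcd (∏ j ∈ u, x j) ∣ ∏ j ∈ u, (x i).gcd (x j) := by
          intro u
          induction u using Finset.induction_on with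
          | empty => simp
          | insert j u hj ihu =>
            rw [Finset.prod_insert hj, Finset.prod_insert hj]
            exact (Nat.gcd_mul_right_dvd_mul_gcd _ _ _).trans (mul_dvd_mul_left _ ihu)
        exact (Nat.gcd_dvd_gcd_of_dvd_right _
          (Finset.lcm_dvd fun j hj => Finset.dvd_prod_of_mem x hj)).trans (h2 s)
      calc (x i).gcd (s.lcm x) ≤ ∏ j ∈ s, (x i).gcd (x j) :=
            Nat.le_of_dvd (Finset.prod_pos fun j _ => Nat.gcd_pos_of_pos_left _ hxi) h1
        _ ≤ ∏ _j ∈ s, B := Finset.prod_le_prod' fun j hj =>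
            hg i (Finset.mem_insert_self i s) j (Finset.mem_insert_of_mem hj)
              fun h => hi (h ▸ hj)
        _ = B ^ s.card := by simp
        _ ≤ B ^ r := Nat.pow_le_pow_right hB (by omega)
    have hlcm : (insert i s).lcm x = (x i).lcm (s.lcm x) := Finset.lcm_insert
    rw [Finset.prod_insert hi, hlcm, hcard]
    calc x i * ∏ j ∈ s, x j ≤ x i * (s.lcm x * (B ^ r) ^ s.card) := by gcongr
      _ = (x i * s.lcm x) * (B ^ r) ^ s.card := by ring
      _ = ((x i).gcd (s.lcm x) * (x i).lcm (s.lcm x)) * (B ^ r) ^ s.card := by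
          rw [Nat.gcd_mul_lcm]
      _ ≤ (B ^ r * (x i).lcm (s.lcm x)) * (B ^ r) ^ s.card := by gcongr
      _ = _ := by ring

theorem card_le_div_add_one_of_modEq (N L : ℕ) (S : Finset ℕ)
    (hS : ∀ n ∈ S, n ≤ N) (hmod : ∀ m ∈ S, ∀ n ∈ S, m ≡ n [MOD L]) :
    S.card ≤ N / L + 1 := by
  rw [← Finset.card_range (N / L + 1)]
  refine Finset.card_le_card_of_injOn (fun n => n / L) (fun n hn => ?_) fun m hm n hn h => ?_
  · simpa [Nat.lt_succ_iff] using Nat.div_le_div_right (hS n hn)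
  · have h1 := hmod m hm n hn
    rw [← Nat.div_add_mod m L, ← Nat.div_add_mod n L, h1]
    simp only at h
    rw [h]

theorem card_filter_pow_dvd_add_le (k R : ℕ) (a : Fin R → ℕ) (ha : Function.Injective a)
    (N : ℕ) (d : Fin R → ℕ) (hd : ∀ i, 1 ≤ d i) :
    (((Finset.Icc 1 N).filter fun n => ∀ i, d i ^ k ∣ n + a i).card : ℝ) ≤
      ((((1 + ∑ i, a i) ^ R) ^ R : ℕ) : ℝ) * N / ((∏ i, d i : ℕ) : ℝ) ^ k + 1 := by
  set S := (Finset.Icc 1 N).filter fun n => ∀ i, d i ^ k ∣ n + a i with hSdef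
  set x : Fin R → ℕ := fun i => d i ^ k with hxdef
  have hx : ∀ i, 0 < x i := fun i => Nat.pow_pos (hd i)
  set L := Finset.univ.lcm x with hL
  have hLpos : 0 < L := Nat.pos_of_ne_zero fun h => by
    obtain ⟨i, -, hi⟩ := Finset.lcm_eq_zero_iff.1 h
    exact (hx i).ne' hi
  rcases S.eq_empty_or_nonempty with hS | ⟨n₀, hn₀⟩
  · rw [hS]; simp only [Finset.card_empty, Nat.cast_zero]; positivity
  have hmod : ∀ m ∈ S, ∀ n ∈ S, m ≡ n [MOD L] := by
    intro m hm n hn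
    have hm' := (Finset.mem_filter.1 hm).2
    have hn' := (Finset.mem_filter.1 hn).2
    rw [Nat.modEq_iff_dvd]
    have hx' : ∀ i, (x i : ℤ) ∣ (n : ℤ) - m := fun i => by
      have h1 : (x i : ℤ) ∣ ((n + a i : ℕ) : ℤ) := by exact_mod_cast hn' i
      have h2 : (x i : ℤ) ∣ ((m + a i : ℕ) : ℤ) := by exact_mod_cast hm' i
      have h3 := dvd_sub h1 h2
      push_cast at h3
      simpa using h3
    rw [Int.natCast_dvd]
    exact Finset.lcm_dvd fun i _ => Int.natCast_dvd.1 (hx' i)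
  have hg : ∀ i ∈ Finset.univ, ∀ j ∈ Finset.univ, i ≠ j → (x i).gcd (x j) ≤ 1 + ∑ i, a i := by
    intro i _ j _ hij
    have hn' := (Finset.mem_filter.1 hn₀).2
    have h1 : (((x i).gcd (x j) : ℕ) : ℤ) ∣ ((n₀ + a i : ℕ) : ℤ) :=
      Int.natCast_dvd_natCast.2 ((Nat.gcd_dvd_left _ _).trans (hn' i))
    have h2 : (((x i).gcd (x j) : ℕ) : ℤ) ∣ ((n₀ + a j : ℕ) : ℤ) :=
      Int.natCast_dvd_natCast.2 ((Nat.gcd_dvd_right _ _).trans (hn' j))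
    have h3 := Int.natCast_dvd.1 (dvd_sub h1 h2)
    have hne : a i ≠ a j := fun h => hij (ha h)
    have hi : a i ≤ ∑ i, a i := Finset.single_le_sum (f := a) (fun _ _ => Nat.zero_le _) (Finset.mem_univ i)
    have hj : a j ≤ ∑ i, a i := Finset.single_le_sum (f := a) (fun _ _ => Nat.zero_le _) (Finset.mem_univ j)
    have := Nat.le_of_dvd (by omega) h3
    omega
  have hprod := prod_le_lcm_mul_pow Finset.univ x (1 + ∑ i, a i) R (by omega) (by simp)
    (fun i _ => hx i) hg
  have hcard := card_le_div_add_one_of_modEq N L S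
    (fun n hn => (Finset.mem_Icc.1 (Finset.mem_filter.1 hn).1).2) hmod
  simp only [hxdef, Finset.prod_pow, Finset.card_univ, Fintype.card_fin] at hprod
  rw [← hxdef, ← hL] at hprod
  set G := ((1 + ∑ i, a i) ^ R) ^ R with hG
  have hq : 0 < ∏ i, d i := Finset.prod_pos fun i _ => hd i
  have hcard' : (S.card : ℝ) ≤ ((N / L : ℕ) : ℝ) + 1 := by exact_mod_cast hcard
  have hdiv : ((N / L : ℕ) : ℝ) ≤ (N : ℝ) / L := Nat.cast_div_le
  have hprod' : (((∏ i, d i : ℕ) : ℝ)) ^ k ≤ L * G := by exact_mod_cast hprod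
  have hq' : (0 : ℝ) < ((∏ i, d i : ℕ) : ℝ) ^ k := by positivity
  have hL' : (0 : ℝ) < L := by exact_mod_cast hLpos
  have : (N : ℝ) / L ≤ G * N / ((∏ i, d i : ℕ) : ℝ) ^ k := by
    rw [div_le_div_iff₀ hL' hq']
    calc (N : ℝ) * _ ≤ N * (L * G) := by gcongr
      _ = _ := by ring
  linarith

theorem exists_subset_prod_mem_Ioc {ι : Type*} [Fintype ι] (d : ι → ℕ) (A w : ℝ) (hA : 1 ≤ A)
    (hw : 1 ≤ w) (hd : ∀ i, (d i : ℝ) ≤ A * w ^ 2) (hprod : w < ((∏ i, d i : ℕ) : ℝ)) :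
    ∃ I : Finset ι, w < ((∏ i ∈ I, d i : ℕ) : ℝ) ∧ ((∏ i ∈ I, d i : ℕ) : ℝ) ≤ A * w ^ 2 := by
  by_cases hbig : ∃ i, w < d i
  · obtain ⟨i, hi⟩ := hbig
    exact ⟨{i}, by simpa using hi, by simpa using hd i⟩
  push Not at hbig
  by_contra! hcon
  have hall : ∀ s : Finset ι, ((∏ i ∈ s, d i : ℕ) : ℝ) ≤ w := by
    intro s
    induction s using Finset.induction_on with
    | empty => simpa using hw
    | insert i s hi ih =>
      by_contra! hlt
      have := hcon _ hlt
      rw [Finset.prod_insert hi, Nat.cast_mul] at this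
      have h1 : (d i : ℝ) * ((∏ i ∈ s, d i : ℕ) : ℝ) ≤ w * w := by
        gcongr
        exact hbig i
      nlinarith [sq_nonneg w]
  exact absurd hprod (not_lt.2 (hall Finset.univ))

/-- Pairs `(n, d)` with `1 ≤ n ≤ N`, all `d i ≥ 1`, and `d i ^ k ∣ n + a i` for all `i`. The upper
bound on the `d i` is automatic when `k ≠ 0`; it only serves to make the set finite. -/
noncomputable def powDvdPairs (k : ℕ) {R : ℕ} (a : Fin R → ℕ) (N : ℕ) :
    Finset (ℕ × (Fin R → ℕ)) :=
  (Finset.Icc 1 N ×ˢ Fintype.piFinset fun _ => Finset.Icc 1 (N + ∑ i, a i)).filter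
    fun p => ∀ i, p.2 i ^ k ∣ p.1 + a i

theorem le_of_pow_dvd_add {k R : ℕ} (hk : k ≠ 0) (a : Fin R → ℕ) {N n d : ℕ} (hn : 1 ≤ n)
    (hnN : n ≤ N) {i : Fin R} (h : d ^ k ∣ n + a i) : d ^ k ≤ N + ∑ i, a i ∧
      d ≤ N + ∑ i, a i := by
  have h1 := Nat.le_of_dvd (by omega) h
  have h2 : a i ≤ ∑ i, a i :=
    Finset.single_le_sum (f := a) (fun _ _ => Nat.zero_le _) (Finset.mem_univ i)
  have h3 := Nat.le_self_pow hk d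
  omega

theorem mem_powDvdPairs {k R : ℕ} (hk : k ≠ 0) {a : Fin R → ℕ} {N : ℕ}
    {p : ℕ × (Fin R → ℕ)} :
    p ∈ powDvdPairs k a N ↔
      (1 ≤ p.1 ∧ p.1 ≤ N) ∧ (∀ i, 1 ≤ p.2 i) ∧ ∀ i, p.2 i ^ k ∣ p.1 + a i := by
  simp only [powDvdPairs, Finset.mem_filter, Finset.mem_product, Finset.mem_Icc,
    Fintype.mem_piFinset]
  constructor
  · rintro ⟨⟨h1, h2⟩, h3⟩
    exact ⟨h1, fun i => (h2 i).1, h3⟩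
  · rintro ⟨h1, h2, h3⟩
    exact ⟨⟨h1, fun i => ⟨h2 i, (le_of_pow_dvd_add hk a h1.1 h1.2 (h3 i)).2⟩⟩, h3⟩

theorem tsum_card_eq_card_filter_powDvdPairs {k R : ℕ} (hk : k ≠ 0) (a : Fin R → ℕ) (N : ℕ)
    (Y : ℝ) :
    (∑' d : Fin R → ℕ,
        if (∀ i, 1 ≤ d i) ∧ (Y < ∏ i, (d i : ℝ))
        then ((((Finset.Icc 1 N).filter fun n => ∀ i, d i ^ k ∣ n + a i).card : ℕ) : ℝ)
        else 0) =
      ((powDvdPairs k a N).filter fun p => Y < ((∏ i, p.2 i : ℕ) : ℝ)).card := by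
  rw [tsum_eq_sum (s := Fintype.piFinset fun _ => Finset.Icc 1 (N + ∑ i, a i))]
  · rw [Finset.card_eq_sum_card_fiberwise (f := Prod.snd)
      (t := Fintype.piFinset fun _ => Finset.Icc 1 (N + ∑ i, a i))]
    · push_cast
      refine Finset.sum_congr rfl fun d hd => ?_
      simp only [Fintype.mem_piFinset, Finset.mem_Icc] at hd
      split_ifs with h
      · congr 1
        refine Finset.card_bij (fun n _ => (n, d)) ?_ ?_ ?_
        · intro n hn
          simp only [Finset.mem_filter, Finset.mem_Icc] at hn
          simp only [Finset.mem_filter, mem_powDvdPairs hk]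
          exact ⟨⟨⟨hn.1, h.1, hn.2⟩, by simpa using h.2⟩, trivial⟩
        · intro m _ n _ hmn
          exact (Prod.ext_iff.1 hmn).1
        · rintro ⟨n, e⟩ hp
          simp only [Finset.mem_filter, mem_powDvdPairs hk] at hp
          obtain ⟨⟨⟨h1, -, h3⟩, -⟩, rfl⟩ := hp
          exact ⟨n, by simp only [Finset.mem_filter, Finset.mem_Icc]; exact ⟨h1, h3⟩, rfl⟩
      · symm
        rw [Nat.cast_eq_zero, Finset.card_eq_zero, Finset.eq_empty_iff_forall_notMem]
        rintro ⟨n, e⟩ hp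
        simp only [Finset.mem_filter, mem_powDvdPairs hk] at hp
        obtain ⟨⟨⟨-, h2, -⟩, h4⟩, rfl⟩ := hp
        exact h ⟨h2, by simpa using h4⟩
    · intro p hp
      have := (Finset.mem_filter.1 (Finset.mem_filter.1 (Finset.mem_coe.1 hp)).1).1
      exact Finset.mem_coe.2 (Finset.mem_product.1 this).2
  · intro d hd
    split_ifs with h
    · rw [Nat.cast_eq_zero, Finset.card_eq_zero, Finset.eq_empty_iff_forall_notMem]
      intro n hn
      simp only [Finset.mem_filter, Finset.mem_Icc] at hn
      refine hd (Fintype.mem_piFinset.2 fun i => Finset.mem_Icc.2 ⟨h.1 i, ?_⟩)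
      exact (le_of_pow_dvd_add hk a hn.1.1 hn.1.2 (hn.2 i)).2
    · rfl

theorem card_le_pow_of_fst_eq {k R : ℕ} (hk : k ≠ 0) (a : Fin R → ℕ) (N T n : ℕ)
    (hT : ∀ x : ℕ, x ≠ 0 → x ≤ N + ∑ i, a i → x.divisors.card ≤ T)
    (S : Finset (ℕ × (Fin R → ℕ))) (hS : S ⊆ powDvdPairs k a N) (hn : ∀ p ∈ S, p.1 = n) :
    S.card ≤ T ^ R := by
  rcases S.eq_empty_or_nonempty with rfl | ⟨p₀, hp₀⟩
  · simp
  have hn₀ := ((mem_powDvdPairs hk).1 (hS hp₀)).1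
  rw [hn p₀ hp₀] at hn₀
  calc S.card ≤ (Fintype.piFinset fun i => (n + a i).divisors).card := by
        refine Finset.card_le_card_of_injOn Prod.snd (fun p hp => ?_) fun p hp q hq h => ?_
        · have h := ((mem_powDvdPairs hk).1 (hS hp)).2.2
          rw [hn p hp] at h
          refine Finset.mem_coe.2 (Fintype.mem_piFinset.2 fun i => Nat.mem_divisors.2 ⟨?_, by omega⟩)
          exact (dvd_pow_self _ hk).trans (h i)
        · exact Prod.ext ((hn p hp).trans (hn q hq).symm) h
    _ = ∏ i, (n + a i).divisors.card := Fintype.card_piFinset _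
    _ ≤ ∏ _i : Fin R, T := Finset.prod_le_prod' fun i _ => by
        refine hT _ (by omega) ?_
        have h2 : a i ≤ ∑ i, a i :=
          Finset.single_le_sum (f := a) (fun _ _ => Nat.zero_le _) (Finset.mem_univ i)
        omega
    _ = T ^ R := by simp

theorem card_powDvdPairs_le {k R : ℕ} (hk : k ≠ 0) (a : Fin R → ℕ) (N T : ℕ)
    (hT : ∀ x : ℕ, x ≠ 0 → x ≤ N + ∑ i, a i → x.divisors.card ≤ T) :
    (powDvdPairs k a N).card ≤ N * T ^ R := by
  rw [Finset.card_eq_sum_card_fiberwise (f := Prod.fst) (t := Finset.Icc 1 N)]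
  · refine (Finset.sum_le_card_nsmul _ _ (T ^ R) fun n _ => ?_).trans (by simp)
    exact card_le_pow_of_fst_eq hk a N T n hT _ (Finset.filter_subset _ _)
      fun p hp => (Finset.mem_filter.1 hp).2
  · exact fun p hp => Finset.mem_coe.2 (Finset.mem_Icc.2 ((mem_powDvdPairs hk).1 hp).1)

theorem card_powDvdPairs_prod_eq_le {k R : ℕ} (hk : k ≠ 0) (a : Fin R → ℕ)
    (ha : Function.Injective a) (N T q : ℕ) (hq : q ≠ 0) (hT : q.divisors.card ≤ T) :
    (((powDvdPairs k a N).filter fun p => ∏ i, p.2 i = q).card : ℝ) ≤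
      (T : ℝ) ^ R * ((((1 + ∑ i, a i) ^ R) ^ R : ℕ) * N / (q : ℝ) ^ k + 1) := by
  set c : ℝ := (((1 + ∑ i, a i) ^ R) ^ R : ℕ) * N / (q : ℝ) ^ k + 1 with hc
  rw [Finset.card_eq_sum_card_fiberwise (f := Prod.snd)
    (t := Fintype.piFinset fun _ => q.divisors)]
  · push_cast
    refine (Finset.sum_le_card_nsmul _ _ c fun d hd => ?_).trans ?_
    · rcases Finset.eq_empty_or_nonempty
        (((powDvdPairs k a N).filter fun p => ∏ i, p.2 i = q).filter fun p => p.2 = d)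
        with h | ⟨p₀, hp₀⟩
      · rw [h]; simp only [Finset.card_empty, Nat.cast_zero]; positivity
      simp only [Finset.mem_filter, mem_powDvdPairs hk] at hp₀
      obtain ⟨⟨⟨-, h2, -⟩, h4⟩, h5⟩ := hp₀
      rw [h5] at h2 h4
      have hle := card_filter_pow_dvd_add_le k R a ha N d h2
      rw [h4] at hle
      refine le_trans ?_ hle
      rw [Nat.cast_le]
      refine Finset.card_le_card_of_injOn Prod.fst (fun p hp => ?_) fun p hp q hq h => ?_
      · simp only [Finset.coe_filter, Finset.mem_filter, mem_powDvdPairs hk, Set.mem_ofPred_eq] at hp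
        obtain ⟨⟨⟨h1, -, h3⟩, -⟩, rfl⟩ := hp
        simp only [Finset.coe_filter, Finset.mem_Icc, Set.mem_ofPred_eq]
        exact ⟨h1, h3⟩
      · exact Prod.ext h ((Finset.mem_filter.1 hp).2.trans (Finset.mem_filter.1 hq).2.symm)
    · rw [nsmul_eq_mul, Fintype.card_piFinset]
      simp only [Finset.prod_const, Finset.card_univ, Fintype.card_fin]
      push_cast
      gcongr
  · intro p hp
    have hp := (Finset.mem_filter.1 hp).2
    refine Finset.mem_coe.2 (Fintype.mem_piFinset.2 fun i => Nat.mem_divisors.2 ⟨?_, hq⟩)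
    rw [← hp]
    exact Finset.dvd_prod_of_mem _ (Finset.mem_univ i)

theorem card_powDvdPairs_prod_mem_Ioc_le {k R : ℕ} (hk : k ≠ 0) (a : Fin R → ℕ)
    (ha : Function.Injective a) (N T : ℕ) (X Y Z ε : ℝ) (hY : 0 < Y) (hZ : 0 ≤ Z) (hZX : Z ≤ X)
    (hε : 0 < ε) (hεk : ε ≤ k - 1)
    (hT : ∀ x : ℕ, x ≠ 0 → (x : ℝ) ≤ X → x.divisors.card ≤ T) :
    (((powDvdPairs k a N).filter fun p =>
        Y < ((∏ i, p.2 i : ℕ) : ℝ) ∧ ((∏ i, p.2 i : ℕ) : ℝ) ≤ Z).card : ℝ) ≤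
      (T : ℝ) ^ R * ((((1 + ∑ i, a i) ^ R) ^ R : ℕ) * (∑' n : ℕ, 1 / (n : ℝ) ^ (1 + ε)) *
        (N * Y ^ (1 - (k : ℝ) + ε)) + Z) := by
  set G : ℝ := ((((1 + ∑ i, a i) ^ R) ^ R : ℕ) : ℝ)
  have hG : 0 ≤ G := Nat.cast_nonneg _
  rw [Finset.card_eq_sum_card_fiberwise (f := fun p => ∏ i, p.2 i)
    (t := (Finset.Icc 1 ⌊Z⌋₊).filter fun q : ℕ => Y < q)]
  · push_cast
    have hterm : ∀ q ∈ (Finset.Icc 1 ⌊Z⌋₊).filter fun q : ℕ => Y < q,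
        ((((powDvdPairs k a N).filter fun p =>
          Y < ∏ i, (p.2 i : ℝ) ∧ ∏ i, (p.2 i : ℝ) ≤ Z).filter
            fun p => ∏ i, p.2 i = q).card : ℝ) ≤
        (T : ℝ) ^ R * (G * N * Y ^ (1 - (k : ℝ) + ε) * (1 / (q : ℝ) ^ (1 + ε)) + 1) := by
      intro q hq
      simp only [Finset.mem_filter, Finset.mem_Icc] at hq
      obtain ⟨⟨hq1, hqZ⟩, hYq⟩ := hq
      have hq0 : (0 : ℝ) < q := by exact_mod_cast hq1
      have hqZ' : (q : ℝ) ≤ Z := (Nat.le_floor_iff hZ).1 hqZ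
      refine le_trans ?_ ((card_powDvdPairs_prod_eq_le hk a ha N T q (by omega)
        (hT q (by omega) (hqZ'.trans hZX))).trans ?_)
      · exact_mod_cast Finset.card_le_card
          (Finset.filter_subset_filter _ (Finset.filter_subset _ _))
      · have h1 : (q : ℝ) ^ (1 - (k : ℝ) + ε) ≤ Y ^ (1 - (k : ℝ) + ε) :=
          Real.rpow_le_rpow_of_nonpos hY hYq.le (by linarith)
        have h2 : 1 / (q : ℝ) ^ k = (q : ℝ) ^ (1 - (k : ℝ) + ε) * (1 / (q : ℝ) ^ (1 + ε)) := by
          rw [one_div, one_div, ← Real.rpow_natCast, ← Real.rpow_neg hq0.le,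
            ← Real.rpow_neg hq0.le, ← Real.rpow_add hq0]
          congr 1
          ring
        refine mul_le_mul_of_nonneg_left (add_le_add ?_ le_rfl) (by positivity)
        calc G * N / (q : ℝ) ^ k = G * N * (1 / (q : ℝ) ^ k) := by ring
          _ = G * N * (q : ℝ) ^ (1 - (k : ℝ) + ε) * (1 / (q : ℝ) ^ (1 + ε)) := by
              rw [h2, mul_assoc (G * N)]
          _ ≤ _ := by gcongr
    refine (Finset.sum_le_sum hterm).trans ?_
    rw [← Finset.mul_sum, Finset.sum_add_distrib, ← Finset.mul_sum]
    refine mul_le_mul_of_nonneg_left (add_le_add ?_ ?_) (by positivity)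
    · have hs : Summable fun n : ℕ => 1 / (n : ℝ) ^ (1 + ε) :=
        Real.summable_one_div_nat_rpow.2 (by linarith)
      have := hs.sum_le_tsum ((Finset.Icc 1 ⌊Z⌋₊).filter fun q : ℕ => Y < q)
        fun _ _ => by positivity
      have hc : 0 ≤ G * N * Y ^ (1 - (k : ℝ) + ε) := by positivity
      exact (mul_le_mul_of_nonneg_left this hc).trans_eq (by ring)
    · rw [Finset.sum_const, nsmul_eq_mul, mul_one]
      refine le_trans ?_ (Nat.floor_le hZ)
      have := Finset.card_filter_le (Finset.Icc 1 ⌊Z⌋₊) fun q : ℕ => Y < q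
      rw [Nat.card_Icc] at this
      exact_mod_cast this
  · intro p hp
    obtain ⟨hp, hpY, hpZ⟩ := Finset.mem_filter.1 hp
    have hpos : 0 < ∏ i, p.2 i := Finset.prod_pos fun i _ => ((mem_powDvdPairs hk).1 hp).2.1 i
    refine Finset.mem_coe.2 (Finset.mem_filter.2 ⟨Finset.mem_Icc.2 ⟨hpos, ?_⟩, hpY⟩)
    exact Nat.le_floor hpZ

theorem card_powDvdPairs_lt_prod_le {k R : ℕ} (hk : k ≠ 0) (a : Fin R → ℕ) (N T : ℕ) (A w : ℝ)
    (hA : 1 ≤ A) (hw : 1 ≤ w)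
    (hd : ∀ d : ℕ, d ^ k ≤ N + ∑ i, a i → (d : ℝ) ≤ A * w ^ 2)
    (hT : ∀ x : ℕ, x ≠ 0 → x ≤ N + ∑ i, a i → x.divisors.card ≤ T) :
    ((powDvdPairs k a N).filter fun p => w < ((∏ i, p.2 i : ℕ) : ℝ)).card ≤
      T ^ R * ((powDvdPairs k a N).filter fun p =>
        w < ((∏ i, p.2 i : ℕ) : ℝ) ∧ ((∏ i, p.2 i : ℕ) : ℝ) ≤ A * w ^ 2).card := by
  have hex : ∀ p : ℕ × (Fin R → ℕ), ∃ I : Finset (Fin R),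
      p ∈ (powDvdPairs k a N).filter (fun p => w < ((∏ i, p.2 i : ℕ) : ℝ)) →
      w < ((∏ i ∈ I, p.2 i : ℕ) : ℝ) ∧ ((∏ i ∈ I, p.2 i : ℕ) : ℝ) ≤ A * w ^ 2 := by
    intro p
    by_cases hp : p ∈ (powDvdPairs k a N).filter (fun p => w < ((∏ i, p.2 i : ℕ) : ℝ))
    · obtain ⟨hp1, hp2⟩ := Finset.mem_filter.1 hp
      obtain ⟨h1, -, h3⟩ := (mem_powDvdPairs hk).1 hp1
      obtain ⟨I, hI⟩ := exists_subset_prod_mem_Ioc p.2 A w hA hw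
        (fun i => hd _ (le_of_pow_dvd_add hk a h1.1 h1.2 (h3 i)).1) hp2
      exact ⟨I, fun _ => hI⟩
    · exact ⟨∅, fun h => absurd h hp⟩
  choose I hI using hex
  refine Finset.card_le_mul_card_image_of_maps_to
    (f := fun p => (p.1, fun i => if i ∈ I p then p.2 i else 1)) (fun p hp => ?_) _ fun b _ => ?_
  · obtain ⟨h1, h2, h3⟩ := (mem_powDvdPairs hk).1 (Finset.mem_filter.1 hp).1
    have hprod : ∏ i, (if i ∈ I p then p.2 i else 1) = ∏ i ∈ I p, p.2 i := by simp
    refine Finset.mem_filter.2 ⟨(mem_powDvdPairs hk).2 ⟨h1, fun i => ?_, fun i => ?_⟩, ?_⟩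
    · dsimp only
      split_ifs
      · exact h2 i
      · exact le_rfl
    · dsimp only
      split_ifs
      · exact h3 i
      · simp
    · rw [hprod]
      exact hI p hp
  · refine card_le_pow_of_fst_eq hk a N T b.1 hT _
      ((Finset.filter_subset _ _).trans (Finset.filter_subset _ _)) fun p hp => ?_
    exact (Prod.ext_iff.1 (Finset.mem_filter.1 hp).2).1

theorem exists_nat_card_divisors_le_pow_le (R : ℕ) (hR : 1 ≤ R) (A δ : ℝ) (hA : 1 ≤ A)
    (hδ : 0 < δ) :
    ∃ C : ℝ, 0 ≤ C ∧ ∀ t : ℝ, 1 ≤ t → ∃ T : ℕ, (T : ℝ) ^ R ≤ C * t ^ δ ∧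
      ∀ x : ℕ, x ≠ 0 → (x : ℝ) ≤ A * t → x.divisors.card ≤ T := by
  have hR0 : (0 : ℝ) < R := by exact_mod_cast hR
  obtain ⟨C, hC, hdiv⟩ := exists_card_divisors_le_rpow (δ / R) (by positivity)
  refine ⟨C ^ R * A ^ δ, by positivity, fun t ht => ⟨⌊C * (A * t) ^ (δ / R)⌋₊, ?_, ?_⟩⟩
  · calc ((⌊C * (A * t) ^ (δ / R)⌋₊ : ℕ) : ℝ) ^ R ≤ (C * (A * t) ^ (δ / R)) ^ R := by
          gcongr
          exact Nat.floor_le (by positivity)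
      _ = C ^ R * A ^ δ * t ^ δ := by
          rw [mul_pow, ← Real.rpow_natCast ((A * t) ^ (δ / R)), ← Real.rpow_mul (by positivity),
            div_mul_cancel₀ _ hR0.ne', Real.mul_rpow (by positivity) (by positivity), mul_assoc]
  · intro x hx hxt
    refine Nat.le_floor ((hdiv x hx).trans ?_)
    gcongr

/-- Let `R ∈ ℕ` and let `a_1, …, a_R` be distinct non-negative integers.  For
`t ≥ 1` and positive integers `d_1, …, d_R` let `𝒩_{d;a}(t)` be the number of positive
integers `n ≤ t` with `n ≡ −a_i (mod d_i^k)` for all `i`.  For every `ε > 0` there is a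
constant `C` such that for all `t ≥ 1` and `Y > 0`:
`Σ_{d_1⋯d_R > Y} 𝒩_{d;a}(t) ≤ C · t^ε · (t·Y^(1−k+ε) + t^(2/(k+1)))`. -/
theorem stmt_3 (k : ℕ) (hk : 2 ≤ k) (R : ℕ) (hR : 1 ≤ R) (a : Fin R → ℕ)
    (ha : Function.Injective a) (ε : ℝ) (hε : 0 < ε) :
    ∃ C : ℝ, ∀ t Y : ℝ, 1 ≤ t → 0 < Y →
      (∑' d : Fin R → ℕ,
        if (∀ i, 1 ≤ d i) ∧ (Y < ∏ i, (d i : ℝ))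
        then ((((Finset.Icc 1 ⌊t⌋₊).filter fun n => ∀ i, d i ^ k ∣ n + a i).card : ℕ) : ℝ)
        else 0)
      ≤ C * t ^ ε * (t * Y ^ (1 - (k : ℝ) + ε) + t ^ (2 / ((k : ℝ) + 1))) := by
  have hk0 : k ≠ 0 := by omega
  have hk2 : (2 : ℝ) ≤ k := by exact_mod_cast hk
  set A : ℝ := 1 + ((∑ i, a i : ℕ) : ℝ) with hAdef
  have hA : 1 ≤ A := le_add_of_nonneg_right (Nat.cast_nonneg _)
  have hNA : ∀ t : ℝ, 1 ≤ t → ((⌊t⌋₊ + ∑ i, a i : ℕ) : ℝ) ≤ A * t := by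
    intro t ht
    have h1 : ((⌊t⌋₊ : ℕ) : ℝ) ≤ t := Nat.floor_le (by linarith)
    rw [Nat.cast_add, hAdef]
    nlinarith [Nat.cast_nonneg (α := ℝ) (∑ i, a i)]
  rcases lt_or_ge ((k : ℝ) - 1) ε with hεk | hεk
  · obtain ⟨C, hC, hdiv⟩ := exists_nat_card_divisors_le_pow_le R hR A (2 / ((k : ℝ) + 1)) hA
      (by positivity)
    refine ⟨C, fun t Y ht hY => ?_⟩
    rw [tsum_card_eq_card_filter_powDvdPairs hk0]
    obtain ⟨T, hTR, hT⟩ := hdiv t ht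
    have hT' : ∀ x : ℕ, x ≠ 0 → x ≤ ⌊t⌋₊ + ∑ i, a i → x.divisors.card ≤ T := fun x hx hxN =>
      hT x hx (le_trans (by exact_mod_cast hxN) (hNA t ht))
    have h1 := (Finset.card_filter_le _ fun p : ℕ × (Fin R → ℕ) =>
      Y < ((∏ i, p.2 i : ℕ) : ℝ)).trans (card_powDvdPairs_le hk0 a ⌊t⌋₊ T hT')
    have h2 : t ≤ t ^ ε := Real.self_le_rpow_of_one_le ht (by linarith)
    calc _ ≤ ((⌊t⌋₊ * T ^ R : ℕ) : ℝ) := by exact_mod_cast h1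
      _ = (⌊t⌋₊ : ℝ) * (T : ℝ) ^ R := by push_cast; rfl
      _ ≤ t ^ ε * (C * t ^ (2 / ((k : ℝ) + 1))) := by
          gcongr
          exact (Nat.floor_le (by linarith)).trans h2
      _ = C * t ^ ε * (0 + t ^ (2 / ((k : ℝ) + 1))) := by ring
      _ ≤ _ := by gcongr; positivity
  · obtain ⟨C, hC, hdiv⟩ := exists_nat_card_divisors_le_pow_le R hR A (ε / 4) hA (by positivity)
    set K : ℝ := ((((1 + ∑ i, a i) ^ R) ^ R : ℕ) : ℝ) * ∑' n : ℕ, 1 / (n : ℝ) ^ (1 + ε) with hKdef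
    have hK : 0 ≤ K := mul_nonneg (Nat.cast_nonneg _) (tsum_nonneg fun n => by positivity)
    refine ⟨(C + C ^ 2) * (K + A), fun t Y ht hY => ?_⟩
    rw [tsum_card_eq_card_filter_powDvdPairs hk0]
    obtain ⟨T, hTR, hT⟩ := hdiv t ht
    have ht0 : 0 < t := by linarith
    have hT' : ∀ x : ℕ, x ≠ 0 → x ≤ ⌊t⌋₊ + ∑ i, a i → x.divisors.card ≤ T := fun x hx hxN =>
      hT x hx (le_trans (by exact_mod_cast hxN) (hNA t ht))
    set N := ⌊t⌋₊ with hN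
    have hNt : (N : ℝ) ≤ t := Nat.floor_le ht0.le
    set w : ℝ := t ^ (1 / ((k : ℝ) + 1)) with hw
    set V : ℝ := t ^ (2 / ((k : ℝ) + 1)) with hV
    have hw1 : 1 ≤ w := Real.one_le_rpow ht (by positivity)
    have hwV : w ^ 2 = V := by
      rw [hw, hV, ← Real.rpow_natCast, ← Real.rpow_mul ht0.le]
      congr 1
      push_cast
      ring
    have hVt : V ≤ t := by
      calc V ≤ t ^ (1 : ℝ) := Real.rpow_le_rpow_of_exponent_le ht
            ((div_le_one (by positivity)).2 (by linarith))
        _ = t := Real.rpow_one t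
    have htV : t ≤ V ^ k := by
      rw [hV, ← Real.rpow_natCast, ← Real.rpow_mul ht0.le]
      refine Real.self_le_rpow_of_one_le ht ?_
      rw [div_mul_eq_mul_div, le_div_iff₀ (by positivity)]
      linarith
    have hd : ∀ d : ℕ, d ^ k ≤ N + ∑ i, a i → (d : ℝ) ≤ A * w ^ 2 := by
      intro d hd
      rw [hwV]
      refine (pow_le_pow_iff_left₀ (by positivity) (by positivity) hk0).1 ?_
      calc (d : ℝ) ^ k ≤ ((N + ∑ i, a i : ℕ) : ℝ) := by exact_mod_cast hd
        _ ≤ A * t := hNA t ht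
        _ ≤ A ^ k * V ^ k := by
            gcongr
            exact le_self_pow₀ hA hk0
        _ = (A * V) ^ k := (mul_pow _ _ _).symm
    have hwt : t * w ^ (1 - (k : ℝ) + ε) ≤ V * t ^ (ε / 2) := by
      calc t * w ^ (1 - (k : ℝ) + ε)
          = t ^ (1 + 1 / ((k : ℝ) + 1) * (1 - (k : ℝ) + ε)) := by
            rw [Real.rpow_add ht0, Real.rpow_one, Real.rpow_mul ht0.le]
        _ = t ^ (2 / ((k : ℝ) + 1) + ε / ((k : ℝ) + 1)) := by
            congr 1
            field_simp
            ring
        _ ≤ t ^ (2 / ((k : ℝ) + 1) + ε / 2) := by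
            refine Real.rpow_le_rpow_of_exponent_le ht ?_
            gcongr
            linarith
        _ = V * t ^ (ε / 2) := Real.rpow_add ht0 _ _
    have hsplit : ((powDvdPairs k a N).filter fun p => Y < ((∏ i, p.2 i : ℕ) : ℝ)).card ≤
        ((powDvdPairs k a N).filter fun p =>
          Y < ((∏ i, p.2 i : ℕ) : ℝ) ∧ ((∏ i, p.2 i : ℕ) : ℝ) ≤ A * w ^ 2).card +
        ((powDvdPairs k a N).filter fun p => w < ((∏ i, p.2 i : ℕ) : ℝ)).card := by
      refine (Finset.card_le_card fun p hp => ?_).trans (Finset.card_union_le _ _)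
      obtain ⟨hp1, hp2⟩ := Finset.mem_filter.1 hp
      rcases le_or_gt ((∏ i, p.2 i : ℕ) : ℝ) w with h | h
      · refine Finset.mem_union_left _ (Finset.mem_filter.2 ⟨hp1, hp2, h.trans ?_⟩)
        nlinarith
      · exact Finset.mem_union_right _ (Finset.mem_filter.2 ⟨hp1, h⟩)
    have hZX : A * w ^ 2 ≤ A * t := by rw [hwV]; gcongr
    have hFY := card_powDvdPairs_prod_mem_Ioc_le hk0 a ha N T (A * t) Y (A * w ^ 2) ε hY
      (by positivity) hZX hε hεk hT
    have hFw := card_powDvdPairs_prod_mem_Ioc_le hk0 a ha N T (A * t) w (A * w ^ 2) ε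
      (by positivity) (by positivity) hZX hε hεk hT
    have hlarge : (((powDvdPairs k a N).filter fun p => w < ((∏ i, p.2 i : ℕ) : ℝ)).card : ℝ) ≤
        (T : ℝ) ^ R * ((powDvdPairs k a N).filter fun p =>
          w < ((∏ i, p.2 i : ℕ) : ℝ) ∧ ((∏ i, p.2 i : ℕ) : ℝ) ≤ A * w ^ 2).card := by
      exact_mod_cast card_powDvdPairs_lt_prod_le hk0 a N T A w hA hw1 hd hT'
    rw [← hKdef, hwV] at hFY hFw
    rw [hwV] at hsplit hlarge
    set U : ℝ := t * Y ^ (1 - (k : ℝ) + ε) with hU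
    have hU0 : 0 ≤ U := by positivity
    have hV0 : 0 ≤ V := by positivity
    have hFY' : (T : ℝ) ^ R * (K * (N * Y ^ (1 - (k : ℝ) + ε)) + A * V) ≤
        C * t ^ ε * ((K + A) * (U + V)) := by
      have h1 : N * Y ^ (1 - (k : ℝ) + ε) ≤ U := by rw [hU]; gcongr
      have h2 : t ^ (ε / 4) ≤ t ^ ε := Real.rpow_le_rpow_of_exponent_le ht (by linarith)
      calc _ ≤ C * t ^ ε * (K * U + A * V) := by
            gcongr
            exact hTR.trans (by gcongr)
        _ ≤ _ := by
            gcongr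
            nlinarith [mul_nonneg hK hV0, mul_nonneg (zero_le_one.trans hA) hU0]
    have hFw' : (T : ℝ) ^ R * ((T : ℝ) ^ R * (K * (N * w ^ (1 - (k : ℝ) + ε)) + A * V)) ≤
        C ^ 2 * t ^ ε * ((K + A) * (U + V)) := by
      have h1 : N * w ^ (1 - (k : ℝ) + ε) ≤ V * t ^ (ε / 2) := le_trans (by gcongr) hwt
      have h2 : 1 ≤ t ^ (ε / 2) := Real.one_le_rpow ht (by positivity)
      have h3 : t ^ (ε / 4) * t ^ (ε / 4) * t ^ (ε / 2) = t ^ ε := by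
        rw [← Real.rpow_add ht0, ← Real.rpow_add ht0]
        congr 1
        ring
      calc _ ≤ (C * t ^ (ε / 4)) * ((C * t ^ (ε / 4)) *
              (K * (V * t ^ (ε / 2)) + A * (V * t ^ (ε / 2)))) := by
            gcongr
            exact le_mul_of_one_le_right hV0 h2
        _ = C ^ 2 * (t ^ (ε / 4) * t ^ (ε / 4) * t ^ (ε / 2)) * ((K + A) * V) := by ring
        _ ≤ _ := by
            rw [h3]
            gcongr
            linarith
    have hsplit' := (Nat.cast_le (α := ℝ)).2 hsplit
    rw [Nat.cast_add] at hsplit'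
    calc _ ≤ _ := hsplit'
      _ ≤ C * t ^ ε * ((K + A) * (U + V)) + C ^ 2 * t ^ ε * ((K + A) * (U + V)) :=
          add_le_add (hFY.trans hFY')
            (hlarge.trans ((mul_le_mul_of_nonneg_left hFw (by positivity)).trans hFw'))
      _ = _ := by ring
end
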